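/- arXiv:2511.02502 — 2 statements merged into one kernel-verified Lean document; each statement's English description precedes it below -/
import Mathlib

section
/- Let α, β ∈ ℝ and let f be a probability density function on (x_i, x_f) (with x_i > −∞) that is differentiable with f'(x) < 0 on (x_i, x_f). Let g = 𝔇_{α,β}[f] be its biparametric down transform. Then, provided the integrals below are finite, the Shannon entropy of g satisfies S[g] = α S[f] + β ∫ f(x) log|f'(x)| dx. -/
open MeasureTheory Set Filter Topology

noncomputable section

/-- The open interval with extended-real endpoints, viewed as a set of reals. -/
def intIoo (a b : EReal) : Set ℝ := {x : ℝ | a < (x : EReal) ∧ (x : EReal) < b}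

theorem isOpen_intIoo (a b : EReal) : IsOpen (intIoo a b) :=
  (isOpen_Ioo (a := a) (b := b)).preimage continuous_coe_real_ereal

theorem ordConnected_intIoo (a b : EReal) : (intIoo a b).OrdConnected :=
  ⟨fun _ hx _ hy _ hz => ⟨hx.1.trans_le (EReal.coe_le_coe_iff.2 hz.1),
    (EReal.coe_le_coe_iff.2 hz.2).trans_lt hy.2⟩⟩

/-- A nonnegative function with negative derivative on an open interval is positive there. -/
theorem pos_of_nonneg_of_hasDerivAt_neg {I : Set ℝ} (hI : IsOpen I) (hI' : I.OrdConnected)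
    {f f' : ℝ → ℝ} (hf_nonneg : ∀ x ∈ I, 0 ≤ f x) (hf' : ∀ x ∈ I, HasDerivAt f (f' x) x)
    (hf'_neg : ∀ x ∈ I, f' x < 0) {x : ℝ} (hx : x ∈ I) : 0 < f x := by
  have hanti : StrictAntiOn f I := by
    refine strictAntiOn_of_deriv_neg hI'.convex
      (fun y hy => (hf' y hy).continuousAt.continuousWithinAt) fun y hy => ?_
    have hy' := interior_subset hy
    rw [(hf' y hy').deriv]
    exact hf'_neg y hy'
  obtain ⟨y, hyI, hxy⟩ : ∃ y ∈ I, x < y :=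
    ((eventually_nhdsWithin_of_eventually_nhds (hI.eventually_mem hx)).and
      (self_mem_nhdsWithin : Ioi x ∈ 𝓝[>] x)).exists
  exact (hf_nonneg y hyI).trans_lt (hanti hx hyI hxy)

/-- Shannon entropy of the biparametric down transform:
`S[𝔇_{α,β}[f]] = α S[f] + β ∫ f log|f'|`. -/
theorem shannon_entropy_of_biparametric_down_transform
    (α β : ℝ) (xi : ℝ) (xf : EReal) (hif : (xi : EReal) < xf)
    (f f' s g : ℝ → ℝ)
    (hf_meas : Measurable f)
    (hf_nonneg : ∀ x, 0 ≤ f x)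
    (hf_supp : ∀ x ∉ intIoo (xi : EReal) xf, f x = 0)
    (hf_int : (∫ x, f x) = 1)
    (hf' : ∀ x ∈ intIoo (xi : EReal) xf, HasDerivAt f (f' x) x)
    (hf'_neg : ∀ x ∈ intIoo (xi : EReal) xf, f' x < 0)
    (hs : ∀ x ∈ intIoo (xi : EReal) xf,
      HasDerivAt s (f x ^ (1 - α) * |f' x| ^ β) x)
    (hs_mono : StrictMonoOn s (intIoo (xi : EReal) xf))
    (hg : ∀ x ∈ intIoo (xi : EReal) xf, g (s x) = f x ^ α * |f' x| ^ (-β))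
    (hg_supp : ∀ y ∉ s '' intIoo (xi : EReal) xf, g y = 0)
    (hg_meas : Measurable g)
    (hint1 : Integrable (fun x => f x * Real.log (f x)))
    (hint2 : Integrable (fun x => f x * Real.log |f' x|))
    (hint3 : Integrable (fun y => g y * Real.log (g y))) :
    (-∫ y, g y * Real.log (g y))
      = α * (-∫ x, f x * Real.log (f x)) + β * (∫ x, f x * Real.log |f' x|) := by
  set I := intIoo (xi : EReal) xf
  have hopen : IsOpen I := isOpen_intIoo _ _
  have hleft : ∫ y, g y * Real.log (g y) = ∫ y in s '' I, g y * Real.log (g y) :=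
    (setIntegral_eq_integral_of_forall_compl_eq_zero fun y hy => by simp [hg_supp y hy]).symm
  have hright : ∫ x in I, (α * (f x * Real.log (f x)) - β * (f x * Real.log |f' x|))
      = ∫ x, (α * (f x * Real.log (f x)) - β * (f x * Real.log |f' x|)) :=
    setIntegral_eq_integral_of_forall_compl_eq_zero fun x hx => by simp [hf_supp x hx]
  have hchange : ∫ y in s '' I, g y * Real.log (g y)
      = ∫ x in I, (α * (f x * Real.log (f x)) - β * (f x * Real.log |f' x|)) := by
    rw [integral_image_eq_integral_abs_deriv_smul hopen.measurableSet
      (fun x hx => (hs x hx).hasDerivWithinAt) hs_mono.injOn]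
    refine setIntegral_congr_fun hopen.measurableSet fun x hx => ?_
    have hfx : 0 < f x := pos_of_nonneg_of_hasDerivAt_neg hopen (ordConnected_intIoo _ _)
      (fun x _ => hf_nonneg x) hf' hf'_neg hx
    have hf'x : 0 < |f' x| := abs_pos.2 (hf'_neg x hx).ne
    have hmul : f x ^ (1 - α) * |f' x| ^ β * (f x ^ α * |f' x| ^ (-β)) = f x := by
      rw [mul_mul_mul_comm, ← Real.rpow_add hfx, ← Real.rpow_add hf'x]
      simp
    have hlog : Real.log (f x ^ α * |f' x| ^ (-β))
        = α * Real.log (f x) - β * Real.log |f' x| := by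
      rw [Real.log_mul (by positivity) (by positivity), Real.log_rpow hfx, Real.log_rpow hf'x]
      ring
    simp only [smul_eq_mul]
    rw [hg x hx, abs_of_nonneg (by positivity), ← mul_assoc, hmul, hlog]
    ring
  rw [hleft, hchange, hright, integral_sub (hint1.const_mul α) (hint2.const_mul β),
    integral_const_mul, integral_const_mul]
  ring
end
end

section
/- Let P > 0 and (α, β) ∈ ℝ². Let g(x) = a e^{−|x|^{P}} with a = (2Γ(1+1/P))^{−1}, a probability density, and set K = σ_P[g] / e^{S[g]}. Then for every probability density function f that is differentiable with f' < 0 on its interval support (x_i, x_f), Ξ_{P,α,β}[f]^{1/P} ≥ K · e^{α S[f]} · e^{β ∫ f(x) log|f'(x)| dx}, whenever all quantities are finite. -/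
open MeasureTheory Set Filter Topology

noncomputable section

theorem measurableSet_intIoo (a b : EReal) : MeasurableSet (intIoo a b) :=
  (isOpen_intIoo a b).measurableSet

theorem intIoo_subset_intIoo_left {a b : EReal} {x : ℝ} (hx : x ∈ intIoo a b) :
    intIoo (x : EReal) b ⊆ intIoo a b :=
  fun _ ht => ⟨hx.1.trans ht.1, ht.2⟩

theorem intIoo_coe_eq_union {b : EReal} {x y : ℝ} (hxy : x ≤ y) (hy : (y : EReal) < b) :
    intIoo (x : EReal) b = Ioc x y ∪ intIoo (y : EReal) b := by
  ext t
  simp only [intIoo, mem_ofPred_eq, mem_union, mem_Ioc, EReal.coe_lt_coe_iff]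
  constructor
  · rintro ⟨h1, h2⟩
    rcases le_or_gt t y with h | h
    · exact Or.inl ⟨h1, h⟩
    · exact Or.inr ⟨h, h2⟩
  · rintro (⟨h1, h2⟩ | ⟨h1, h2⟩)
    · exact ⟨h1, (EReal.coe_le_coe_iff.2 h2).trans_lt hy⟩
    · exact ⟨hxy.trans_lt h1, h2⟩

theorem exists_gt_mem_intIoo {a b : EReal} {x : ℝ} (hx : x ∈ intIoo a b) :
    ∃ y ∈ intIoo a b, x < y := by
  obtain ⟨y, hxy, hyb⟩ := EReal.exists_between_coe_real hx.2
  exact ⟨y, ⟨hx.1.trans hxy, hyb⟩, EReal.coe_lt_coe_iff.1 hxy⟩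

theorem volume_intIoo_pos {a b : EReal} (hab : a < b) : 0 < volume (intIoo a b) := by
  obtain ⟨y, hy⟩ := EReal.exists_between_coe_real hab
  exact (isOpen_intIoo a b).measure_pos volume ⟨y, hy⟩

/-- The integral of `h` over the part of the line between `x` and `b`. -/
def tailIntegral (h : ℝ → ℝ) (b : EReal) (x : ℝ) : ℝ :=
  ∫ t in intIoo (x : EReal) b, h t

section Tail

variable {a b : EReal} {h : ℝ → ℝ}

theorem tailIntegral_eq_add
    (hint : ∀ x ∈ intIoo a b, IntegrableOn h (intIoo (x : EReal) b))
    {x y : ℝ} (hx : x ∈ intIoo a b) (hy : (y : EReal) < b) (hxy : x ≤ y) :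
    tailIntegral h b x = (∫ t in x..y, h t) + tailIntegral h b y := by
  have hu := intIoo_coe_eq_union hxy hy
  have hi := hint x hx
  rw [hu] at hi
  rw [tailIntegral, hu, setIntegral_union _ (measurableSet_intIoo _ _) hi.left_of_union
    hi.right_of_union, intervalIntegral.integral_of_le hxy, tailIntegral]
  rw [Set.disjoint_left]
  intro t ht ht'
  exact absurd (EReal.coe_lt_coe_iff.1 ht'.1) (not_lt.2 ht.2)

theorem strictAntiOn_tailIntegral
    (hint : ∀ x ∈ intIoo a b, IntegrableOn h (intIoo (x : EReal) b))
    (hpos : ∀ x ∈ intIoo a b, 0 < h x) :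
    StrictAntiOn (tailIntegral h b) (intIoo a b) := by
  intro x hx y hy hxy
  rw [tailIntegral_eq_add hint hx hy.2 hxy.le]
  have hi := hint x hx
  rw [intIoo_coe_eq_union hxy.le hy.2] at hi
  have := intervalIntegral.intervalIntegral_pos_of_pos_on
    ((intervalIntegrable_iff_integrableOn_Ioc_of_le hxy.le).2 hi.left_of_union)
    (fun t ht => hpos t ⟨hx.1.trans (EReal.coe_lt_coe_iff.2 ht.1),
      (EReal.coe_lt_coe_iff.2 ht.2).trans hy.2⟩) hxy
  linarith

theorem tailIntegral_pos
    (hint : ∀ x ∈ intIoo a b, IntegrableOn h (intIoo (x : EReal) b))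
    (hpos : ∀ x ∈ intIoo a b, 0 < h x) {x : ℝ} (hx : x ∈ intIoo a b) :
    0 < tailIntegral h b x := by
  obtain ⟨y, hy, hxy⟩ := exists_gt_mem_intIoo hx
  refine lt_of_le_of_lt ?_ (strictAntiOn_tailIntegral hint hpos hx hy hxy)
  exact setIntegral_nonneg (measurableSet_intIoo _ _)
    fun t ht => (hpos t (intIoo_subset_intIoo_left hy ht)).le

theorem ae_hasDerivAt_tailIntegral
    (hint : ∀ x ∈ intIoo a b, IntegrableOn h (intIoo (x : EReal) b)) :
    ∀ᵐ x, x ∈ intIoo a b → HasDerivAt (tailIntegral h b) (-h x) x := by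
  have key : ∀ q : ℚ, (q : ℝ) ∈ intIoo a b →
      ∀ᵐ x, x ∈ intIoo ((q : ℝ) : EReal) b → HasDerivAt (tailIntegral h b) (-h x) x := by
    intro q hq
    have hm := measurableSet_intIoo ((q : ℝ) : EReal) b
    have hli : LocallyIntegrable ((intIoo ((q : ℝ) : EReal) b).indicator h) :=
      ((integrable_indicator_iff hm).2 (hint q hq)).locallyIntegrable
    filter_upwards [LocallyIntegrable.ae_hasDerivAt_integral hli] with x hx hxq
    have hd := (hx q).const_sub (tailIntegral h b q)
    rw [indicator_of_mem hxq] at hd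
    refine hd.congr_of_eventuallyEq ?_
    filter_upwards [(isOpen_intIoo _ _).mem_nhds hxq] with y hy
    have hqy : (q : ℝ) ≤ y := (EReal.coe_lt_coe_iff.1 hy.1).le
    rw [tailIntegral_eq_add hint hq hy.2 hqy]
    have : (∫ t in (q : ℝ)..y, (intIoo ((q : ℝ) : EReal) b).indicator h t)
        = ∫ t in (q : ℝ)..y, h t := by
      rw [intervalIntegral.integral_of_le hqy, intervalIntegral.integral_of_le hqy]
      refine setIntegral_congr_fun measurableSet_Ioc fun t ht => ?_
      exact indicator_of_mem (show t ∈ intIoo _ b from ⟨EReal.coe_lt_coe_iff.2 ht.1,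
        (EReal.coe_le_coe_iff.2 ht.2).trans_lt hy.2⟩) h
    rw [this]
    ring
  have key' : ∀ᵐ x, ∀ q : ℚ, (q : ℝ) ∈ intIoo a b →
      x ∈ intIoo ((q : ℝ) : EReal) b → HasDerivAt (tailIntegral h b) (-h x) x := by
    rw [ae_all_iff]
    intro q
    by_cases hq : (q : ℝ) ∈ intIoo a b
    · filter_upwards [key q hq] with x hx _ using hx
    · exact Eventually.of_forall fun x hx => absurd hx hq
  filter_upwards [key'] with x hx hxI
  obtain ⟨q, haq, hqx⟩ := EReal.lt_iff_exists_rat_btwn.1 hxI.1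
  exact hx q ⟨haq, hqx.trans hxI.2⟩ ⟨hqx, hxI.2⟩

/-- Change of variables along the tail integral of a positive function. -/
theorem lintegral_mul_comp_tailIntegral_le
    (hint : ∀ x ∈ intIoo a b, IntegrableOn h (intIoo (x : EReal) b))
    (hpos : ∀ x ∈ intIoo a b, 0 < h x) (G : ℝ → ENNReal) :
    ∫⁻ x in intIoo a b, ENNReal.ofReal (h x) * G (tailIntegral h b x) ≤ ∫⁻ y in Ioi 0, G y := by
  set N := {x | ¬ (x ∈ intIoo a b → HasDerivAt (tailIntegral h b) (-h x) x)} with hN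
  have hN0 : volume N = 0 := ae_hasDerivAt_tailIntegral hint
  set s := intIoo a b \ toMeasurable volume N with hs
  have hsm : MeasurableSet s := (measurableSet_intIoo a b).diff (measurableSet_toMeasurable _ _)
  have hsI : s ⊆ intIoo a b := sdiff_subset
  have hae : s =ᵐ[volume] intIoo a b :=
    sdiff_null_ae_eq_self (by rw [measure_toMeasurable, hN0])
  rw [← setLIntegral_congr hae]
  have hd : ∀ x ∈ s, HasDerivWithinAt (tailIntegral h b) (-h x) s x := by
    intro x hx
    have : x ∉ N := fun hxN => hx.2 (subset_toMeasurable _ _ hxN)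
    exact ((not_not.1 this) hx.1).hasDerivWithinAt
  have himg := lintegral_image_eq_lintegral_abs_deriv_mul hsm hd
    ((strictAntiOn_tailIntegral hint hpos).injOn.mono hsI) G
  calc ∫⁻ x in s, ENNReal.ofReal (h x) * G (tailIntegral h b x)
      = ∫⁻ x in s, ENNReal.ofReal |-h x| * G (tailIntegral h b x) := by
        refine setLIntegral_congr_fun hsm fun x hx => ?_
        simp only [abs_neg, abs_of_pos (hpos x (hsI hx))]
    _ = ∫⁻ y in tailIntegral h b '' s, G y := himg.symm
    _ ≤ ∫⁻ y in Ioi 0, G y := by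
        refine lintegral_mono_set ?_
        rintro _ ⟨x, hx, rfl⟩
        exact tailIntegral_pos hint hpos (hsI hx)

end Tail

/-- Normalizing constant of the density proportional to `exp (-|x| ^ P)`. -/
def genGaussianConst (P : ℝ) : ℝ := (2 * Real.Gamma (1 + 1 / P))⁻¹

theorem genGaussianConst_pos {P : ℝ} (hP : 0 < P) : 0 < genGaussianConst P := by
  have : 0 < Real.Gamma (1 + 1 / P) := Real.Gamma_pos_of_pos (by positivity)
  unfold genGaussianConst
  positivity

theorem integral_genGaussian {P : ℝ} (hP : 0 < P) :
    ∫ x : ℝ, genGaussianConst P * Real.exp (-|x| ^ P) = 1 := by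
  have hΓ : 0 < Real.Gamma (1 + 1 / P) := Real.Gamma_pos_of_pos (by positivity)
  have h1 := integral_exp_neg_mul_rpow hP one_pos
  rw [Real.one_rpow, one_mul, add_comm (1 / P)] at h1
  simp only [neg_mul, one_mul] at h1
  rw [integral_const_mul, integral_comp_abs (f := fun x => Real.exp (-x ^ P)), h1,
    genGaussianConst]
  exact inv_mul_cancel₀ (by positivity)

theorem integral_abs_rpow_mul_genGaussian {P : ℝ} (hP : 0 < P) :
    ∫ x : ℝ, |x| ^ P * (genGaussianConst P * Real.exp (-|x| ^ P)) = 1 / P := by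
  have hΓ : 0 < Real.Gamma (1 + 1 / P) := Real.Gamma_pos_of_pos (by positivity)
  have h1 := integral_rpow_mul_exp_neg_rpow hP (show -1 < P by linarith)
  rw [show (P + 1) / P = 1 + 1 / P by field_simp] at h1
  simp_rw [mul_left_comm _ (genGaussianConst P)]
  rw [integral_const_mul, integral_comp_abs (f := fun x => x ^ P * Real.exp (-x ^ P)), h1,
    genGaussianConst]
  field_simp

theorem integral_genGaussian_mul_log {P : ℝ} (hP : 0 < P)
    (hint : Integrable fun x : ℝ => |x| ^ P * (genGaussianConst P * Real.exp (-|x| ^ P))) :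
    ∫ x : ℝ, genGaussianConst P * Real.exp (-|x| ^ P)
        * Real.log (genGaussianConst P * Real.exp (-|x| ^ P))
      = Real.log (genGaussianConst P) - 1 / P := by
  have h1 : ∀ x : ℝ, genGaussianConst P * Real.exp (-|x| ^ P)
        * Real.log (genGaussianConst P * Real.exp (-|x| ^ P))
      = Real.log (genGaussianConst P) * (genGaussianConst P * Real.exp (-|x| ^ P))
        - |x| ^ P * (genGaussianConst P * Real.exp (-|x| ^ P)) := by
    intro x
    rw [Real.log_mul (genGaussianConst_pos hP).ne' (Real.exp_pos _).ne', Real.log_exp]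
    ring
  simp_rw [h1]
  rw [integral_sub ((integrable_of_integral_eq_one (integral_genGaussian hP)).const_mul _) hint,
    integral_const_mul, integral_genGaussian hP, integral_abs_rpow_mul_genGaussian hP, mul_one]

theorem lintegral_scaled_genGaussian_le_one {P b : ℝ} (hP : 0 < P) (hb : 0 < b) :
    ∫⁻ y in Ioi (0 : ℝ),
      ENNReal.ofReal (genGaussianConst P * b ^ (1 / P) * Real.exp (-b * y ^ P)) ≤ 1 := by
  have hΓ : 0 < Real.Gamma (1 + 1 / P) := Real.Gamma_pos_of_pos (by positivity)
  have hc := genGaussianConst_pos hP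
  have hi : IntegrableOn (fun y : ℝ => Real.exp (-b * y ^ P)) (Ioi 0) := by
    simpa using integrableOn_rpow_mul_exp_neg_mul_rpow (s := 0) (by norm_num) hP hb
  rw [← ofReal_integral_eq_lintegral_ofReal (hi.const_mul _)
    (Eventually.of_forall fun y => by positivity), integral_const_mul,
    integral_exp_neg_mul_rpow hP hb, ENNReal.ofReal_le_one]
  have hbb : b ^ (1 / P) * b ^ (-1 / P) = 1 := by
    rw [← Real.rpow_add hb, show 1 / P + -1 / P = 0 by ring, Real.rpow_zero]
  calc genGaussianConst P * b ^ (1 / P) * (b ^ (-1 / P) * Real.Gamma (1 / P + 1))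
      = genGaussianConst P * Real.Gamma (1 + 1 / P) * (b ^ (1 / P) * b ^ (-1 / P)) := by
        rw [add_comm (1 / P)]; ring
    _ = 1 / 2 := by rw [hbb, genGaussianConst]; field_simp
    _ ≤ 1 := by norm_num

/-- Moment-entropy inequality for the image of the density `f` under the tail integral of `h`. -/
theorem log_moment_entropy_tailIntegral {P : ℝ} (hP : 0 < P) {a b : EReal} (hab : a < b)
    {f h : ℝ → ℝ} (hf_pos : ∀ x ∈ intIoo a b, 0 < f x)
    (hf_one : ∫ x in intIoo a b, f x = 1)
    (hpos : ∀ x ∈ intIoo a b, 0 < h x)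
    (hh : AEMeasurable h (volume.restrict (intIoo a b)))
    (hint : ∀ x ∈ intIoo a b, IntegrableOn h (intIoo (x : EReal) b))
    (hent : IntegrableOn (fun x => f x * (Real.log (h x) - Real.log (f x))) (intIoo a b))
    (hmom : IntegrableOn (fun x => tailIntegral h b x ^ P * f x) (intIoo a b)) :
    0 < (∫ x in intIoo a b, tailIntegral h b x ^ P * f x) ∧
    (∫ x in intIoo a b, f x * (Real.log (h x) - Real.log (f x))) + Real.log (genGaussianConst P)
      ≤ (Real.log (P * ∫ x in intIoo a b, tailIntegral h b x ^ P * f x) + 1) / P := by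
  have hI := measurableSet_intIoo a b
  have hF : ∀ x ∈ intIoo a b, 0 < tailIntegral h b x := fun x hx => tailIntegral_pos hint hpos hx
  set M := ∫ x in intIoo a b, tailIntegral h b x ^ P * f x with hM
  have hMpos : 0 < M := by
    have hp : ∀ x ∈ intIoo a b, 0 < tailIntegral h b x ^ P * f x := fun x hx =>
      mul_pos (Real.rpow_pos_of_pos (hF x hx) _) (hf_pos x hx)
    rw [hM, setIntegral_pos_iff_support_of_nonneg_ae
      (ae_restrict_of_forall_mem hI fun x hx => (hp x hx).le) hmom]
    refine (volume_intIoo_pos hab).trans_le (measure_mono fun x hx => ⟨(hp x hx).ne', hx⟩)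
  refine ⟨hMpos, ?_⟩
  set k : ℝ := (P * M)⁻¹ with hk
  have hkpos : 0 < k := by positivity
  set c := genGaussianConst P * k ^ (1 / P) with hc
  have hcpos : 0 < c := mul_pos (genGaussianConst_pos hP) (Real.rpow_pos_of_pos hkpos _)
  set w : ℝ → ℝ := fun x => h x * (c * Real.exp (-k * tailIntegral h b x ^ P)) with hw
  have hwpos : ∀ x ∈ intIoo a b, 0 < w x := fun x hx =>
    mul_pos (hpos x hx) (mul_pos hcpos (Real.exp_pos _))
  have hFm : AEMeasurable (tailIntegral h b) (volume.restrict (intIoo a b)) :=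
    aemeasurable_restrict_of_antitoneOn hI (strictAntiOn_tailIntegral hint hpos).antitoneOn
  have hwm : AEMeasurable w (volume.restrict (intIoo a b)) :=
    hh.mul ((Real.measurable_exp.comp_aemeasurable ((hFm.pow_const P).const_mul _)).const_mul _)
  have hwl : ∫⁻ x in intIoo a b, ENNReal.ofReal (w x) ≤ 1 := by
    refine le_trans (le_of_eq ?_) ((lintegral_mul_comp_tailIntegral_le hint hpos
      fun y => ENNReal.ofReal (c * Real.exp (-k * y ^ P))).trans
        (lintegral_scaled_genGaussian_le_one hP hkpos))
    exact setLIntegral_congr_fun hI fun x hx => ENNReal.ofReal_mul (hpos x hx).le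
  have hw0 : 0 ≤ᵐ[volume.restrict (intIoo a b)] w :=
    ae_restrict_of_forall_mem hI fun x hx => (hwpos x hx).le
  have hwi : IntegrableOn w (intIoo a b) := by
    refine ⟨hwm.aestronglyMeasurable, ?_⟩
    rw [hasFiniteIntegral_iff_ofReal hw0]
    exact hwl.trans_lt ENNReal.one_lt_top
  have hw1 : ∫ x in intIoo a b, w x ≤ 1 := by
    rw [integral_eq_lintegral_of_nonneg_ae hw0 hwm.aestronglyMeasurable]
    exact ENNReal.toReal_le_of_le_ofReal zero_le_one (by simpa using hwl)
  have hfi : IntegrableOn f (intIoo a b) := integrable_of_integral_eq_one hf_one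
  have hle : ∀ x ∈ intIoo a b,
      f x * (Real.log (h x) - Real.log (f x)) + Real.log c * f x
        - k * (tailIntegral h b x ^ P * f x) ≤ w x - f x := by
    intro x hx
    have hfx := hf_pos x hx
    have hl := Real.log_le_sub_one_of_pos (div_pos (hwpos x hx) hfx)
    rw [Real.log_div (hwpos x hx).ne' hfx.ne', hw,
      Real.log_mul (hpos x hx).ne' (mul_pos hcpos (Real.exp_pos _)).ne',
      Real.log_mul hcpos.ne' (Real.exp_pos _).ne', Real.log_exp] at hl
    have := mul_le_mul_of_nonneg_left hl hfx.le
    have he : f x * (w x / f x - 1) = w x - f x := by field_simp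
    rw [← he]
    refine le_trans (le_of_eq ?_) this
    ring
  have hent' : IntegrableOn (fun x => f x * (Real.log (h x) - Real.log (f x))
      + Real.log c * f x) (intIoo a b) := hent.add (hfi.const_mul _)
  have hmono := setIntegral_mono_on (hent'.sub (hmom.const_mul k)) (hwi.sub hfi) hI hle
  simp only [Pi.sub_apply] at hmono
  rw [integral_sub hent' (hmom.const_mul k), integral_add hent (hfi.const_mul _), integral_sub hwi hfi, integral_const_mul,
    integral_const_mul, hf_one, ← hM] at hmono
  have hkM : k * M = 1 / P := by rw [hk]; field_simp
  have hlogc : Real.log c = Real.log (genGaussianConst P) - Real.log (P * M) / P := by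
    rw [hc, Real.log_mul (genGaussianConst_pos hP).ne' (Real.rpow_pos_of_pos hkpos _).ne',
      Real.log_rpow hkpos, hk, Real.log_inv]
    ring
  rw [hkM, hlogc] at hmono
  rw [add_div]
  linarith

theorem strictAntiOn_intIoo_of_hasDerivAt_neg {a b : EReal} {f f' : ℝ → ℝ}
    (hf' : ∀ x ∈ intIoo a b, HasDerivAt f (f' x) x) (hneg : ∀ x ∈ intIoo a b, f' x < 0) :
    StrictAntiOn f (intIoo a b) := by
  have hconv : Convex ℝ (intIoo a b) := by
    refine OrdConnected.convex ⟨fun x hx y hy z hz => ?_⟩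
    exact ⟨hx.1.trans_le (EReal.coe_le_coe_iff.2 hz.1), (EReal.coe_le_coe_iff.2 hz.2).trans_lt hy.2⟩
  refine strictAntiOn_of_deriv_neg hconv
    (fun x hx => (hf' x hx).continuousAt.continuousWithinAt) fun x hx => ?_
  rw [(isOpen_intIoo a b).interior_eq] at hx
  rw [(hf' x hx).deriv]
  exact hneg x hx

/-- the down-moment–Shannon inequality
`Ξ_{P,α,β}[f]^{1/P} ≥ K · e^{α S[f]} · e^{β ⟨log|f'|⟩_f}` with
`K = σ_P[g]/e^{S[g]}` for the Gaussian-type density `g(x) = a e^{-|x|^P}`. -/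
theorem down_moment_shannon_inequality
    (P α β : ℝ) (hP : 0 < P)
    (g₀ : ℝ → ℝ)
    (hg₀ : ∀ x, g₀ x = (2 * Real.Gamma (1 + 1 / P))⁻¹ * Real.exp (-|x| ^ P))
    (xi xf : EReal) (hif : xi < xf)
    (f f' : ℝ → ℝ)
    (hf_meas : Measurable f)
    (hf_nonneg : ∀ x, 0 ≤ f x)
    (hf_supp : ∀ x ∉ intIoo xi xf, f x = 0)
    (hf_int : (∫ x, f x) = 1)
    (hf' : ∀ x ∈ intIoo xi xf, HasDerivAt f (f' x) x)
    (hf'_neg : ∀ x ∈ intIoo xi xf, f' x < 0)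
    (hfin_inner : ∀ x ∈ intIoo xi xf,
      IntegrableOn (fun t => f t ^ (1 - α) * |f' t| ^ β) (intIoo (x : EReal) xf))
    (hfin1 : IntegrableOn
      (fun x : ℝ =>
        |(∫ t in intIoo (x : EReal) xf, f t ^ (1 - α) * |f' t| ^ β)| ^ P * f x)
      (intIoo xi xf))
    (hfin2 : IntegrableOn (fun x => f x * Real.log (f x)) (intIoo xi xf))
    (hfin3 : IntegrableOn (fun x => f x * Real.log |f' x|) (intIoo xi xf))
    (hfin4 : Integrable (fun x => |x| ^ P * g₀ x))
    (hfin5 : Integrable (fun x => g₀ x * Real.log (g₀ x))) :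
    (∫ x in intIoo xi xf,
        |(∫ t in intIoo (x : EReal) xf, f t ^ (1 - α) * |f' t| ^ β)| ^ P * f x)
        ^ ((1 : ℝ) / P)
    ≥ ((∫ x, |x| ^ P * g₀ x) ^ ((1 : ℝ) / P)
        / Real.exp (-∫ x, g₀ x * Real.log (g₀ x)))
      * Real.exp (α * (-∫ x in intIoo xi xf, f x * Real.log (f x)))
      * Real.exp (β * ∫ x in intIoo xi xf, f x * Real.log |f' x|) := by
  have hI := measurableSet_intIoo xi xf
  have hanti := strictAntiOn_intIoo_of_hasDerivAt_neg hf' hf'_neg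
  have hf_pos : ∀ x ∈ intIoo xi xf, 0 < f x := fun x hx => by
    obtain ⟨y, hy, hxy⟩ := exists_gt_mem_intIoo hx
    exact (hf_nonneg y).trans_lt (hanti hx hy hxy)
  have hf'_pos : ∀ x ∈ intIoo xi xf, 0 < |f' x| := fun x hx => abs_pos.2 (hf'_neg x hx).ne
  have hf_one : ∫ x in intIoo xi xf, f x = 1 := by
    rw [← hf_int]
    exact setIntegral_eq_integral_of_forall_compl_eq_zero hf_supp
  set h : ℝ → ℝ := fun t => f t ^ (1 - α) * |f' t| ^ β with hh
  have hpos : ∀ x ∈ intIoo xi xf, 0 < h x := fun x hx =>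
    mul_pos (Real.rpow_pos_of_pos (hf_pos x hx) _) (Real.rpow_pos_of_pos (hf'_pos x hx) _)
  have hf'm : AEMeasurable f' (volume.restrict (intIoo xi xf)) :=
    (measurable_deriv f).aemeasurable.congr
      (ae_restrict_of_forall_mem hI fun x hx => (hf' x hx).deriv)
  have hhm : AEMeasurable h (volume.restrict (intIoo xi xf)) :=
    (hf_meas.pow_const _).aemeasurable.mul
      ((measurable_abs.comp_aemeasurable hf'm).pow_const _)
  have hent_eq : ∀ x ∈ intIoo xi xf, f x * (Real.log (h x) - Real.log (f x))
      = β * (f x * Real.log |f' x|) - α * (f x * Real.log (f x)) := by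
    intro x hx
    rw [hh, Real.log_mul (Real.rpow_pos_of_pos (hf_pos x hx) _).ne'
      (Real.rpow_pos_of_pos (hf'_pos x hx) _).ne', Real.log_rpow (hf_pos x hx),
      Real.log_rpow (hf'_pos x hx)]
    ring
  have hent : IntegrableOn (fun x => f x * (Real.log (h x) - Real.log (f x))) (intIoo xi xf) :=
    IntegrableOn.congr_fun ((hfin3.const_mul β).sub (hfin2.const_mul α))
      (fun x hx => (hent_eq x hx).symm) hI
  have hmom_eq : EqOn (fun x : ℝ => |(∫ t in intIoo (x : EReal) xf, h t)| ^ P * f x)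
      (fun x => tailIntegral h xf x ^ P * f x) (intIoo xi xf) := fun x hx => by
    have : 0 < ∫ t in intIoo (x : EReal) xf, h t := tailIntegral_pos hfin_inner hpos hx
    simp only [tailIntegral, abs_of_pos this]
  have hmom := hfin1.congr_fun hmom_eq hI
  obtain ⟨hM, hlog⟩ := log_moment_entropy_tailIntegral hP hif hf_pos hf_one hpos hhm hfin_inner
    hent hmom
  rw [setIntegral_congr_fun hI hent_eq,
    integral_sub (hfin3.const_mul β) (hfin2.const_mul α), integral_const_mul,
    integral_const_mul] at hlog
  rw [setIntegral_congr_fun hI hmom_eq]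
  obtain rfl : g₀ = fun x => genGaussianConst P * Real.exp (-|x| ^ P) := funext hg₀
  rw [integral_abs_rpow_mul_genGaussian hP, integral_genGaussian_mul_log hP hfin4]
  set M := ∫ x in intIoo xi xf, tailIntegral h xf x ^ P * f x
  have hPi : 0 < 1 / P := by positivity
  rw [ge_iff_le, Real.rpow_def_of_pos hM, Real.rpow_def_of_pos hPi, ← Real.exp_sub,
    ← Real.exp_add, ← Real.exp_add, Real.exp_le_exp, one_div P, Real.log_inv]
  rw [Real.log_mul hP.ne' hM.ne'] at hlog
  have he : (Real.log P + Real.log M + 1) / P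
      = Real.log P * P⁻¹ + Real.log M * P⁻¹ + P⁻¹ := by ring
  rw [he] at hlog
  linarith
end
end
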